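/- arXiv:2604.26299 — 3 statements merged into one kernel-verified Lean document; each statement's English description precedes it below -/
import Mathlib

section
/- Let F : (0,∞) → [0,∞) be nonincreasing, let ℓ > 0 and a ∈ ℝ. Then ∫_{x=a−ℓ}^{a} ∫_{y=a}^{a+ℓ} F(y−x)/(y−x) dy dx ≤ 4 ℓ Σ_{k=1}^∞ 2^{-k} F(2^{-k} ℓ), where both sides are taken in [0,∞] (the left side is a Lebesgue integral of a nonnegative function). -/
open MeasureTheory

/-- The part of two adjacent intervals on which `y - x ∈ (r, 2r]` contributes at most
`d * r` times the measure of the admissible range of `x`. -/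
lemma lintegral_indicator_sub_le (d : ENNReal) (r ℓ a : ℝ) :
    ∫⁻ x in Set.Ioc (a - ℓ) a, ∫⁻ y in Set.Ioc a (a + ℓ),
        (Set.Ioc r (2 * r)).indicator (fun _ => d) (y - x) ≤
      d * ENNReal.ofReal r * ENNReal.ofReal (min ℓ (2 * r)) := by
  have hinner : ∀ x ∈ Set.Ioc (a - ℓ) a, ∫⁻ y in Set.Ioc a (a + ℓ),
      (Set.Ioc r (2 * r)).indicator (fun _ => d) (y - x) ≤
        (Set.Ioc (a - 2 * r) a).indicator (fun _ => d * ENNReal.ofReal r) x := by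
    intro x hx
    by_cases hxr : a - 2 * r < x
    · rw [Set.indicator_of_mem (show x ∈ Set.Ioc (a - 2 * r) a from ⟨hxr, hx.2⟩)]
      calc _ ≤ ∫⁻ y, (Set.Ioc r (2 * r)).indicator (fun _ => d) (y - x) :=
            setLIntegral_le_lintegral _ _
        _ = ∫⁻ y, (Set.Ioc r (2 * r)).indicator (fun _ => d) y :=
            lintegral_sub_right_eq_self _ x
        _ = d * ENNReal.ofReal r := by
            rw [lintegral_indicator_const measurableSet_Ioc, Real.volume_Ioc]
            congr 2
            ring
    · refine le_of_eq_of_le ?_ zero_le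
      rw [setLIntegral_congr_fun (g := fun _ => 0) measurableSet_Ioc, lintegral_zero]
      intro y hy
      refine Set.indicator_of_notMem (fun h => ?_) _
      linarith [h.2, hy.1]
  calc _ ≤ ∫⁻ x in Set.Ioc (a - ℓ) a,
          (Set.Ioc (a - 2 * r) a).indicator (fun _ => d * ENNReal.ofReal r) x :=
        setLIntegral_mono' measurableSet_Ioc hinner
    _ = d * ENNReal.ofReal r * ENNReal.ofReal (min ℓ (2 * r)) := by
        rw [lintegral_indicator_const measurableSet_Ioc,
          Measure.restrict_apply measurableSet_Ioc, Set.Ioc_inter_Ioc, Real.volume_Ioc]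
        congr 2
        rw [inf_idem, max_sub_sub_left, sub_sub_cancel, min_comm]

/-- Every `t ∈ (0, 2ℓ)` lies in a dyadic interval `(2⁻ᵏ ℓ, 2 · 2⁻ᵏ ℓ]`. -/
lemma exists_mem_Ioc_inv_two_pow_mul {ℓ t : ℝ} (hℓ : 0 < ℓ) (ht : 0 < t) (ht2 : t < 2 * ℓ) :
    ∃ k : ℕ, t ∈ Set.Ioc ((2 : ℝ)⁻¹ ^ k * ℓ) (2 * ((2 : ℝ)⁻¹ ^ k * ℓ)) := by
  obtain ⟨n, hn, hn'⟩ := exists_nat_pow_near_of_lt_one (x := t / (2 * ℓ)) (y := (2 : ℝ)⁻¹)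
    (by positivity) ((div_le_one (by positivity)).2 ht2.le) (by norm_num) (by norm_num)
  rw [lt_div_iff₀ (by positivity)] at hn
  rw [div_le_iff₀ (by positivity)] at hn'
  refine ⟨n, ?_, ?_⟩
  · rw [pow_succ] at hn
    linarith
  · linarith

/-- for a nonincreasing `F : (0,∞) → [0,∞)`, `ℓ > 0` and `a ∈ ℝ`,
`∫_{x=a−ℓ}^{a} ∫_{y=a}^{a+ℓ} F(y−x)/(y−x) dy dx ≤ 4 ℓ Σ_{k=1}^∞ 2^{-k} F(2^{-k} ℓ)`,
both sides taken in `[0,∞]`. -/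
theorem stmt5 (F : ℝ → ℝ)
    (hF0 : ∀ t, 0 < t → 0 ≤ F t)
    (hFanti : AntitoneOn F (Set.Ioi (0 : ℝ)))
    (ℓ : ℝ) (hℓ : 0 < ℓ) (a : ℝ) :
    ∫⁻ x in Set.Ioc (a - ℓ) a, ∫⁻ y in Set.Ioc a (a + ℓ),
        ENNReal.ofReal (F (y - x) / (y - x)) ≤
      ENNReal.ofReal (4 * ℓ) *
        ∑' k : ℕ, ENNReal.ofReal ((2 : ℝ)⁻¹ ^ (k + 1) * F ((2 : ℝ)⁻¹ ^ (k + 1) * ℓ)) := by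
  set r : ℕ → ℝ := fun k => (2 : ℝ)⁻¹ ^ k * ℓ with hr
  have hr0 : ∀ k, 0 < r k := fun k => by positivity
  set d : ℕ → ENNReal := fun k => ENNReal.ofReal (F (r k) / r k)
  set s : ℕ → ℝ → ENNReal := fun k => (Set.Ioc (r k) (2 * r k)).indicator fun _ => d k
  have hsm : ∀ k, Measurable (s k) := fun k => measurable_const.indicator measurableSet_Ioc
  have hpoint : ∀ t, 0 < t → t < 2 * ℓ → ENNReal.ofReal (F t / t) ≤ ∑' k, s k t := by
    intro t ht ht2
    obtain ⟨k, hk⟩ := exists_mem_Ioc_inv_two_pow_mul hℓ ht ht2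
    refine le_trans ?_ (ENNReal.le_tsum k)
    rw [show s k t = d k from Set.indicator_of_mem hk _]
    exact ENNReal.ofReal_le_ofReal (div_le_div₀ (hF0 _ (hr0 k))
      (hFanti (hr0 k) ht hk.1.le) (hr0 k) hk.1.le)
  have hd : ∀ k c, 0 ≤ c → d k * ENNReal.ofReal (r k) * ENNReal.ofReal c
      = ENNReal.ofReal (F (r k) * c) := by
    intro k c hc
    have hF := hF0 _ (hr0 k)
    rw [← ENNReal.ofReal_mul (div_nonneg hF (hr0 k).le), div_mul_cancel₀ _ (hr0 k).ne',
      ← ENNReal.ofReal_mul hF]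
  set w : ℕ → ENNReal := fun k => ENNReal.ofReal ((2 : ℝ)⁻¹ ^ (k + 1) * F (r (k + 1))) with hw
  have hzero : d 0 * ENNReal.ofReal (r 0) * ENNReal.ofReal (min ℓ (2 * r 0))
      ≤ ENNReal.ofReal (2 * ℓ) * ∑' k, w k := by
    refine le_trans ?_ (mul_le_mul_right (ENNReal.le_tsum 0) _)
    rw [hd 0 _ (le_min hℓ.le (by linarith [hr0 0])), hw,
      ← ENNReal.ofReal_mul (by positivity)]
    apply ENNReal.ofReal_le_ofReal
    have h01 : F (r 0) ≤ F (r 1) := hFanti (hr0 1) (hr0 0) (by simp only [hr]; linarith)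
    calc F (r 0) * min ℓ (2 * r 0) ≤ F (r 1) * ℓ :=
          mul_le_mul h01 (min_le_left _ _) (le_min hℓ.le (by linarith [hr0 0]))
            (hF0 _ (hr0 1))
      _ = _ := by ring_nf
  have hsucc : ∀ k, d (k + 1) * ENNReal.ofReal (r (k + 1)) *
      ENNReal.ofReal (min ℓ (2 * r (k + 1))) ≤ ENNReal.ofReal (2 * ℓ) * w k := by
    intro k
    have hmin : 0 ≤ min ℓ (2 * r (k + 1)) := le_min hℓ.le (by linarith [hr0 (k + 1)])
    rw [hd _ _ hmin, hw, ← ENNReal.ofReal_mul (by positivity)]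
    apply ENNReal.ofReal_le_ofReal
    calc F (r (k + 1)) * min ℓ (2 * r (k + 1)) ≤ F (r (k + 1)) * (2 * r (k + 1)) :=
          mul_le_mul_of_nonneg_left (min_le_right _ _) (hF0 _ (hr0 _))
      _ = 2 * ℓ * ((2 : ℝ)⁻¹ ^ (k + 1) * F (r (k + 1))) := by
          simp only [hr]
          ring
  calc _ ≤ ∫⁻ x in Set.Ioc (a - ℓ) a, ∫⁻ y in Set.Ioc a (a + ℓ), ∑' k, s k (y - x) :=
        setLIntegral_mono' measurableSet_Ioc fun x hx =>
          setLIntegral_mono' measurableSet_Ioc fun y hy =>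
            hpoint _ (by linarith [hx.2, hy.1]) (by linarith [hx.1, hy.2])
    _ = ∑' k, ∫⁻ x in Set.Ioc (a - ℓ) a, ∫⁻ y in Set.Ioc a (a + ℓ), s k (y - x) := by
        rw [← lintegral_tsum]
        · congr 1 with x
          exact lintegral_tsum fun k => ((hsm k).comp (measurable_id.sub_const x)).aemeasurable
        · intro k
          exact (Measurable.lintegral_prod_right' (f := fun p : ℝ × ℝ => s k (p.2 - p.1))
            ((hsm k).comp (measurable_snd.sub measurable_fst))).aemeasurable
    _ ≤ ∑' k, d k * ENNReal.ofReal (r k) * ENNReal.ofReal (min ℓ (2 * r k)) :=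
        ENNReal.tsum_le_tsum fun k => lintegral_indicator_sub_le _ _ _ _
    _ ≤ ENNReal.ofReal (2 * ℓ) * ∑' k, w k + ENNReal.ofReal (2 * ℓ) * ∑' k, w k := by
        rw [tsum_eq_zero_add' ENNReal.summable]
        refine add_le_add hzero ?_
        rw [← ENNReal.tsum_mul_left]
        exact ENNReal.tsum_le_tsum hsucc
    _ = ENNReal.ofReal (4 * ℓ) * ∑' k, w k := by
        rw [← add_mul, ← ENNReal.ofReal_add (by positivity) (by positivity)]
        ring_nf
end

section
/- Let n ≥ 1 and let F₁, F₂, F₃ : [0,∞) → [0,∞) be bounded functions such that F₁ is nondecreasing with F₁(t) → 0 as t → 0⁺, F₂ is nonincreasing with F₂(t) → 0 as t → ∞, and F₃ is nonincreasing with F₃(t) → 0 as t → ∞. Define, for c ∈ ℝⁿ and ℓ > 0, M(c,ℓ) := inf_{x,y,z ∈ Q(c,ℓ)} (1 + |x−y| + |x−z| + |x+y| + |x+z|)/(1 + |x−y| + |x−z|), and F_sep(c,ℓ) := F₁(ℓ) · F₂(ℓ/8) · F₃(M(c,ℓ)). Then F_sep belongs to the class F₀. -/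
/-- The closed cube in `ℝⁿ` with center `c` and sidelength `ℓ`, for the sup norm
`‖x‖ = max_i |x_i|`. -/
def cube (n : ℕ) (c : Fin n → ℝ) (ℓ : ℝ) : Set (Fin n → ℝ) :=
  {x | ‖x - c‖ ≤ ℓ / 2}

/-- The class `F₀`: bounded nonnegative functions of cubes (identified with their center `c` and
sidelength `ℓ > 0`) that vanish as `ℓ → 0`, as `ℓ → ∞`, and as `|c| → ∞`. -/
def MemF0 {n : ℕ} (F : (Fin n → ℝ) → ℝ → ℝ) : Prop :=
  (∀ c ℓ, 0 < ℓ → 0 ≤ F c ℓ) ∧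
  (∃ C : ℝ, ∀ c ℓ, 0 < ℓ → F c ℓ ≤ C) ∧
  (∀ ε > (0 : ℝ), ∃ δ > (0 : ℝ), ∀ c ℓ, 0 < ℓ → ℓ < δ → F c ℓ < ε) ∧
  (∀ ε > (0 : ℝ), ∃ M > (0 : ℝ), ∀ c ℓ, M < ℓ → F c ℓ < ε) ∧
  (∀ ε > (0 : ℝ), ∃ R > (0 : ℝ), ∀ c ℓ, 0 < ℓ → R < ‖c‖ → F c ℓ < ε)

/-- `M(Q) = inf_{x,y,z ∈ Q} (1+|x−y|+|x−z|+|x+y|+|x+z|)/(1+|x−y|+|x−z|)` for the cube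
`Q = Q(c,ℓ)`. -/
noncomputable def Mfun (n : ℕ) (c : Fin n → ℝ) (ℓ : ℝ) : ℝ :=
  sInf {r : ℝ | ∃ x ∈ cube n c ℓ, ∃ y ∈ cube n c ℓ, ∃ z ∈ cube n c ℓ,
    r = (1 + ‖x - y‖ + ‖x - z‖ + ‖x + y‖ + ‖x + z‖) / (1 + ‖x - y‖ + ‖x - z‖)}

theorem Mfun_nonneg (n : ℕ) (c : Fin n → ℝ) (ℓ : ℝ) : 0 ≤ Mfun n c ℓ := by
  apply Real.sInf_nonneg
  rintro r ⟨x, -, y, -, z, -, rfl⟩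
  positivity

theorem norm_sub_le_of_mem_cube {n : ℕ} {c x y : Fin n → ℝ} {ℓ : ℝ}
    (hx : x ∈ cube n c ℓ) (hy : y ∈ cube n c ℓ) : ‖x - y‖ ≤ ℓ := by
  have hx' : ‖x - c‖ ≤ ℓ / 2 := hx
  have hy' : ‖y - c‖ ≤ ℓ / 2 := hy
  have h := norm_sub_le (x - c) (y - c)
  rw [sub_sub_sub_cancel_right] at h
  linarith

theorem le_norm_add_of_mem_cube {n : ℕ} {c x y : Fin n → ℝ} {ℓ : ℝ}
    (hx : x ∈ cube n c ℓ) (hy : y ∈ cube n c ℓ) : 2 * ‖c‖ - ℓ ≤ ‖x + y‖ := by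
  have hx' : ‖x - c‖ ≤ ℓ / 2 := hx
  have hy' : ‖y - c‖ ≤ ℓ / 2 := hy
  have h₁ : ‖(2 : ℝ) • c‖ = 2 * ‖c‖ := by rw [norm_smul]; norm_num
  have h₂ : (2 : ℝ) • c = (x + y) - ((x - c) + (y - c)) := by rw [two_smul]; abel
  have h₃ := norm_sub_le (x + y) ((x - c) + (y - c))
  have h₄ := norm_add_le (x - c) (y - c)
  rw [← h₂, h₁] at h₃
  linarith

theorem le_Mfun {n : ℕ} {c : Fin n → ℝ} {ℓ T : ℝ} (hℓ : 0 ≤ ℓ) (hT : 0 ≤ T)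
    (h : T * (1 + 2 * ℓ) ≤ 2 * (2 * ‖c‖ - ℓ)) : T ≤ Mfun n c ℓ := by
  have hc : c ∈ cube n c ℓ := by
    change ‖c - c‖ ≤ ℓ / 2
    rw [sub_self, norm_zero]
    positivity
  refine le_csInf ⟨_, c, hc, c, hc, c, hc, rfl⟩ ?_
  rintro r ⟨x, hx, y, hy, z, hz, rfl⟩
  rw [le_div_iff₀ (by positivity)]
  have hxy := norm_sub_le_of_mem_cube hx hy
  have hxz := norm_sub_le_of_mem_cube hx hz
  have hxy' := le_norm_add_of_mem_cube hx hy
  have hxz' := le_norm_add_of_mem_cube hx hz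
  calc T * (1 + ‖x - y‖ + ‖x - z‖) ≤ T * (1 + 2 * ℓ) :=
        mul_le_mul_of_nonneg_left (by linarith) hT
    _ ≤ _ := by linarith [norm_nonneg (x - y), norm_nonneg (x - z)]

theorem mul_mul_lt_of_lt_div_sq {a b d C ε : ℝ} (hC : 0 < C) (hb : 0 ≤ b)
    (haC : a ≤ C) (hbC : b ≤ C) (hd : 0 ≤ d) (hdε : d < ε / C ^ 2) : a * b * d < ε := by
  rw [lt_div_iff₀ (by positivity)] at hdε
  calc a * b * d ≤ C * C * d := by gcongr
    _ < ε := by linarith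

/-- `F_sep(Q) = F₁(ℓ(Q)) F₂(ℓ(Q)/8) F₃(M(Q))` belongs to the class `F₀`. -/
theorem stmt6 (n : ℕ) (hn : 1 ≤ n) (F₁ F₂ F₃ : ℝ → ℝ)
    (h₁0 : ∀ t, 0 ≤ t → 0 ≤ F₁ t) (h₁b : ∃ C : ℝ, ∀ t, 0 ≤ t → F₁ t ≤ C)
    (h₁mono : MonotoneOn F₁ (Set.Ici (0 : ℝ)))
    (h₁lim : Filter.Tendsto F₁ (nhdsWithin 0 (Set.Ioi (0 : ℝ))) (nhds 0))
    (h₂0 : ∀ t, 0 ≤ t → 0 ≤ F₂ t) (h₂b : ∃ C : ℝ, ∀ t, 0 ≤ t → F₂ t ≤ C)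
    (h₂anti : AntitoneOn F₂ (Set.Ici (0 : ℝ)))
    (h₂lim : Filter.Tendsto F₂ Filter.atTop (nhds 0))
    (h₃0 : ∀ t, 0 ≤ t → 0 ≤ F₃ t) (h₃b : ∃ C : ℝ, ∀ t, 0 ≤ t → F₃ t ≤ C)
    (h₃anti : AntitoneOn F₃ (Set.Ici (0 : ℝ)))
    (h₃lim : Filter.Tendsto F₃ Filter.atTop (nhds 0)) :
    MemF0 (fun (c : Fin n → ℝ) (ℓ : ℝ) => F₁ ℓ * F₂ (ℓ / 8) * F₃ (Mfun n c ℓ)) := by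
  obtain ⟨C₁, hC₁⟩ := h₁b
  obtain ⟨C₂, hC₂⟩ := h₂b
  obtain ⟨C₃, hC₃⟩ := h₃b
  obtain ⟨C, hC, hC₁', hC₂', hC₃'⟩ : ∃ C : ℝ, 0 < C ∧ C₁ ≤ C ∧ C₂ ≤ C ∧ C₃ ≤ C :=
    ⟨max 1 (max C₁ (max C₂ C₃)), by simp, by simp, by simp, by simp⟩
  replace hC₁ t (ht : 0 ≤ t) : F₁ t ≤ C := (hC₁ t ht).trans hC₁'
  replace hC₂ t (ht : 0 ≤ t) : F₂ t ≤ C := (hC₂ t ht).trans hC₂'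
  replace hC₃ t (ht : 0 ≤ t) : F₃ t ≤ C := (hC₃ t ht).trans hC₃'
  have hM := Mfun_nonneg n
  have hlarge : ∀ ε > (0 : ℝ), ∃ L > (0 : ℝ), ∀ c ℓ, L < ℓ →
      F₁ ℓ * F₂ (ℓ / 8) * F₃ (Mfun n c ℓ) < ε := by
    intro ε hε
    obtain ⟨N, hN⟩ := Filter.eventually_atTop.1
      (h₂lim.eventually_lt_const (show 0 < ε / C ^ 2 by positivity))
    refine ⟨max 1 (8 * N), by simp, fun c ℓ hℓ => ?_⟩
    obtain ⟨hℓ₁, hℓN⟩ := max_lt_iff.1 hℓ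
    have hℓ0 : 0 ≤ ℓ := by linarith
    have hℓ8 : 0 ≤ ℓ / 8 := by positivity
    rw [mul_right_comm]
    exact mul_mul_lt_of_lt_div_sq hC (h₃0 _ (hM c ℓ)) (hC₁ _ hℓ0)
      (hC₃ _ (hM c ℓ)) (h₂0 _ hℓ8) (hN _ (by linarith))
  refine ⟨fun c ℓ hℓ => ?_, ⟨C * C * C, fun c ℓ hℓ => ?_⟩, fun ε hε => ?_, hlarge, fun ε hε => ?_⟩
  · exact mul_nonneg (mul_nonneg (h₁0 _ hℓ.le) (h₂0 _ (by positivity))) (h₃0 _ (hM c ℓ))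
  · have hℓ8 : 0 ≤ ℓ / 8 := by positivity
    exact mul_le_mul (mul_le_mul (hC₁ _ hℓ.le) (hC₂ _ hℓ8) (h₂0 _ hℓ8) hC.le)
      (hC₃ _ (hM c ℓ)) (h₃0 _ (hM c ℓ)) (by positivity)
  · obtain ⟨δ, hδ, hsmall⟩ := mem_nhdsGT_iff_exists_Ioo_subset.1
      (h₁lim.eventually_lt_const (show 0 < ε / C ^ 2 by positivity))
    refine ⟨δ, hδ, fun c ℓ hℓ hℓδ => ?_⟩
    have hℓ8 : 0 ≤ ℓ / 8 := by positivity
    change F₁ ℓ * F₂ (ℓ / 8) * F₃ (Mfun n c ℓ) < ε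
    rw [mul_assoc, mul_comm]
    exact mul_mul_lt_of_lt_div_sq hC (h₃0 _ (hM c ℓ)) (hC₂ _ hℓ8)
      (hC₃ _ (hM c ℓ)) (h₁0 _ hℓ.le) (hsmall ⟨hℓ, hℓδ⟩)
  · obtain ⟨L, hL, hlargeL⟩ := hlarge ε hε
    obtain ⟨N, hN⟩ := Filter.eventually_atTop.1
      (h₃lim.eventually_lt_const (show 0 < ε / C ^ 2 by positivity))
    set T := max N 0
    have hT : 0 ≤ T := le_max_right _ _
    refine ⟨T * (1 + 2 * L) + L, by positivity, fun c ℓ hℓ hc => ?_⟩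
    rcases lt_or_ge L ℓ with hLℓ | hℓL
    · exact hlargeL c ℓ hLℓ
    have hTM : T ≤ Mfun n c ℓ := by
      refine le_Mfun hℓ.le hT ?_
      have : T * (1 + 2 * ℓ) ≤ T * (1 + 2 * L) := by gcongr
      have : 0 ≤ T * (1 + 2 * L) := by positivity
      linarith
    have hℓ8 : 0 ≤ ℓ / 8 := by positivity
    exact mul_mul_lt_of_lt_div_sq hC (h₂0 _ hℓ8) (hC₁ _ hℓ.le) (hC₂ _ hℓ8)
      (h₃0 _ (hM c ℓ)) (hN _ ((le_max_left _ _).trans hTM))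
end

section
/- Let n ≥ 1, let ω : (0,1] → [0,∞) satisfy Σ_{k=0}^∞ ω(2^{-k}) < ∞, and let F₁, F₂, F₃ : [0,∞) → [0,∞) be bounded functions such that F₁ is nondecreasing with F₁(t) → 0 as t → 0⁺, F₂ is nonincreasing with F₂(t) → 0 as t → ∞, and F₃ is nonincreasing with F₃(t) → 0 as t → ∞. Define, for c ∈ ℝⁿ and ℓ > 0, F²(c,ℓ) := Σ_{k=0}^∞ ω(2^{-k}) · F₁(2^k ℓ) · F₂(ℓ) · F₃( 2·| |c| − ℓ | / (1 + 2^k ℓ) ). Then F² belongs to the class F₀. -/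
open Filter Topology in
/-- If one factor decays as `ℓ → ∞` and the other as `2 |r - ℓ| / (1 + A ℓ) → ∞`, then their
product decays as `r → ∞`, uniformly in `ℓ > 0`. -/
theorem exists_mul_lt_of_decay {F G : ℝ → ℝ} {C D A : ℝ} (hA : 0 ≤ A) (hC : 0 < C) (hD : 0 < D)
    (hF0 : ∀ t, 0 ≤ t → 0 ≤ F t) (hF : ∀ t, 0 ≤ t → F t ≤ C) (hFlim : Tendsto F atTop (𝓝 0))
    (hG0 : ∀ t, 0 ≤ t → 0 ≤ G t) (hG : ∀ t, 0 ≤ t → G t ≤ D) (hGlim : Tendsto G atTop (𝓝 0))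
    {ε : ℝ} (hε : 0 < ε) :
    ∃ R : ℝ, ∀ r ℓ, 0 < ℓ → R ≤ r → F ℓ * G (2 * |r - ℓ| / (1 + A * ℓ)) < ε := by
  obtain ⟨M, hM⟩ := eventually_atTop.1 (hFlim.eventually_lt_const (div_pos hε hD))
  obtain ⟨N, hN⟩ := eventually_atTop.1 (hGlim.eventually_lt_const (div_pos hε hC))
  refine ⟨|M| + |N| * (1 + A * |M|), fun r ℓ hℓ hr => ?_⟩
  have hden : 0 < 1 + A * ℓ := by positivity
  have harg : 0 ≤ 2 * |r - ℓ| / (1 + A * ℓ) := by positivity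
  rcases le_total M ℓ with h | h
  · calc F ℓ * G (2 * |r - ℓ| / (1 + A * ℓ)) ≤ F ℓ * D :=
          mul_le_mul_of_nonneg_left (hG _ harg) (hF0 _ hℓ.le)
      _ < ε := (lt_div_iff₀ hD).1 (hM ℓ h)
  · have hℓM : ℓ ≤ |M| := h.trans (le_abs_self M)
    have hNarg : N ≤ 2 * |r - ℓ| / (1 + A * ℓ) := by
      rw [le_div_iff₀ hden]
      calc N * (1 + A * ℓ) ≤ |N| * (1 + A * |M|) := by
            gcongr
            exact le_abs_self N
        _ ≤ |r - ℓ| := by linarith [le_abs_self (r - ℓ)]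
        _ ≤ 2 * |r - ℓ| := by linarith [abs_nonneg (r - ℓ)]
    calc F ℓ * G (2 * |r - ℓ| / (1 + A * ℓ)) ≤ C * G (2 * |r - ℓ| / (1 + A * ℓ)) :=
          mul_le_mul_of_nonneg_right (hF _ hℓ.le) (hG0 _ harg)
      _ < ε := by
          rw [mul_comm]
          exact (lt_div_iff₀ hC).1 (hN _ hNarg)

/-- A bounded function on `[0, ∞)` has a positive upper bound there. -/
theorem exists_pos_bound {F : ℝ → ℝ} (h : ∃ C : ℝ, ∀ t, 0 ≤ t → F t ≤ C) :
    ∃ C : ℝ, 0 < C ∧ ∀ t, 0 ≤ t → F t ≤ C := by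
  obtain ⟨C, hC⟩ := h
  exact ⟨max C 1, by positivity, fun t ht => (hC t ht).trans (le_max_left _ _)⟩

open Filter Topology in
/-- the function
`F²(c,ℓ) = Σ_{k≥0} ω(2^{-k}) F₁(2^k ℓ) F₂(ℓ) F₃(2||c|−ℓ|/(1+2^k ℓ))` belongs to `F₀`. -/
theorem stmt7 (n : ℕ) (hn : 1 ≤ n) (ω : ℝ → ℝ)
    (hω0 : ∀ t ∈ Set.Ioc (0 : ℝ) 1, 0 ≤ ω t)
    (hωs : Summable (fun k : ℕ => ω ((2 : ℝ)⁻¹ ^ k)))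
    (F₁ F₂ F₃ : ℝ → ℝ)
    (h₁0 : ∀ t, 0 ≤ t → 0 ≤ F₁ t) (h₁b : ∃ C : ℝ, ∀ t, 0 ≤ t → F₁ t ≤ C)
    (h₁mono : MonotoneOn F₁ (Set.Ici (0 : ℝ)))
    (h₁lim : Filter.Tendsto F₁ (nhdsWithin 0 (Set.Ioi (0 : ℝ))) (nhds 0))
    (h₂0 : ∀ t, 0 ≤ t → 0 ≤ F₂ t) (h₂b : ∃ C : ℝ, ∀ t, 0 ≤ t → F₂ t ≤ C)
    (h₂anti : AntitoneOn F₂ (Set.Ici (0 : ℝ)))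
    (h₂lim : Filter.Tendsto F₂ Filter.atTop (nhds 0))
    (h₃0 : ∀ t, 0 ≤ t → 0 ≤ F₃ t) (h₃b : ∃ C : ℝ, ∀ t, 0 ≤ t → F₃ t ≤ C)
    (h₃anti : AntitoneOn F₃ (Set.Ici (0 : ℝ)))
    (h₃lim : Filter.Tendsto F₃ Filter.atTop (nhds 0)) :
    MemF0 (fun (c : Fin n → ℝ) (ℓ : ℝ) =>
      ∑' k : ℕ, ω ((2 : ℝ)⁻¹ ^ k) * F₁ (2 ^ k * ℓ) * F₂ ℓ *
        F₃ (2 * |‖c‖ - ℓ| / (1 + 2 ^ k * ℓ))) := by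
  obtain ⟨C₁, hC₁, h₁⟩ := exists_pos_bound h₁b
  obtain ⟨C₂, hC₂, h₂⟩ := exists_pos_bound h₂b
  obtain ⟨C₃, hC₃, h₃⟩ := exists_pos_bound h₃b
  have ha (k : ℕ) : 0 ≤ ω ((2 : ℝ)⁻¹ ^ k) :=
    hω0 _ ⟨by positivity, pow_le_one₀ (by norm_num) (by norm_num)⟩
  set a : ℕ → ℝ := fun k => ω ((2 : ℝ)⁻¹ ^ k)
  let f : (Fin n → ℝ) × ℝ → ℕ → ℝ := fun p k =>
    a k * F₁ (2 ^ k * p.2) * F₂ p.2 * F₃ (2 * |‖p.1‖ - p.2| / (1 + 2 ^ k * p.2))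
  have harg {ℓ : ℝ} (hℓ : 0 < ℓ) (c : Fin n → ℝ) (k : ℕ) :
      0 ≤ 2 * |‖c‖ - ℓ| / (1 + 2 ^ k * ℓ) := by positivity
  have h₁k {ℓ : ℝ} (hℓ : 0 < ℓ) (k : ℕ) : 0 ≤ F₁ (2 ^ k * ℓ) ∧ F₁ (2 ^ k * ℓ) ≤ C₁ :=
    ⟨h₁0 _ (by positivity), h₁ _ (by positivity)⟩
  have hf0 (p : (Fin n → ℝ) × ℝ) (hp : 0 < p.2) (k : ℕ) : 0 ≤ f p k :=
    mul_nonneg (mul_nonneg (mul_nonneg (ha k) (h₁k hp k).1) (h₂0 _ hp.le)) (h₃0 _ (harg hp _ k))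
  have hf₁ (p : (Fin n → ℝ) × ℝ) (hp : 0 < p.2) (k : ℕ) :
      f p k ≤ a k * F₁ (2 ^ k * p.2) * C₂ * C₃ := by
    have := ha k
    have := (h₁k hp k).1
    have := h₂0 _ hp.le
    exact mul_le_mul (mul_le_mul_of_nonneg_left (h₂ _ hp.le) (by positivity))
      (h₃ _ (harg hp _ k)) (h₃0 _ (harg hp _ k)) (by positivity)
  have hf₂₃ (p : (Fin n → ℝ) × ℝ) (hp : 0 < p.2) (k : ℕ) :
      f p k ≤ a k * C₁ * (F₂ p.2 * F₃ (2 * |‖p.1‖ - p.2| / (1 + 2 ^ k * p.2))) := by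
    simp only [f, mul_assoc (a k * F₁ (2 ^ k * p.2))]
    exact mul_le_mul_of_nonneg_right (mul_le_mul_of_nonneg_left (h₁k hp k).2 (ha k))
      (mul_nonneg (h₂0 _ hp.le) (h₃0 _ (harg hp _ k)))
  have hf (p : (Fin n → ℝ) × ℝ) (hp : 0 < p.2) (k : ℕ) : f p k ≤ a k * C₁ * C₂ * C₃ := by
    refine (hf₁ p hp k).trans ?_
    have := ha k
    gcongr
    exact (h₁k hp k).2
  have hsum : Summable fun k => a k * C₁ * C₂ * C₃ :=
    ((hωs.mul_right C₁).mul_right C₂).mul_right C₃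
  have hlim (l : Filter ((Fin n → ℝ) × ℝ)) (hl : ∀ᶠ p in l, 0 < p.2)
      (hk : ∀ k, Tendsto (fun p => f p k) l (𝓝 0)) {ε : ℝ} (hε : 0 < ε) :
      ∀ᶠ p in l, ∑' k, f p k < ε := by
    have h := tendsto_tsum_of_dominated_convergence hsum hk (by
      filter_upwards [hl] with p hp k
      rw [Real.norm_of_nonneg (hf0 p hp k)]
      exact hf p hp k)
    rw [tsum_zero] at h
    exact h.eventually_lt_const hε
  refine ⟨fun c ℓ hℓ => tsum_nonneg (hf0 (c, ℓ) hℓ),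
    ⟨∑' k, a k * C₁ * C₂ * C₃, fun c ℓ hℓ => ?_⟩, fun ε hε => ?_, fun ε hε => ?_, fun ε hε => ?_⟩
  · exact (hsum.of_nonneg_of_le (hf0 (c, ℓ) hℓ) (hf (c, ℓ) hℓ)).tsum_le_tsum (hf (c, ℓ) hℓ) hsum
  · have hl : ∀ᶠ p : (Fin n → ℝ) × ℝ in comap Prod.snd (𝓝[>] (0 : ℝ)), 0 < p.2 :=
      tendsto_comap.eventually self_mem_nhdsWithin
    have h := hlim _ hl (fun k => ?_) hε
    · rw [eventually_comap, eventually_nhdsWithin_iff, Metric.eventually_nhds_iff] at h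
      obtain ⟨δ, hδ, h⟩ := h
      refine ⟨δ, hδ, fun c ℓ hℓ hℓδ => h (y := ℓ) ?_ hℓ (c, ℓ) rfl⟩
      rwa [Real.dist_0_eq_abs, abs_of_pos hℓ]
    · have hscale : Tendsto (fun t : ℝ => 2 ^ k * t) (𝓝[>] (0 : ℝ)) (𝓝[>] (0 : ℝ)) := by
        refine tendsto_nhdsWithin_iff.2 ⟨?_, ?_⟩
        · exact (Continuous.tendsto' (by fun_prop) _ _ (by simp)).mono_left nhdsWithin_le_nhds
        · filter_upwards [self_mem_nhdsWithin] with t ht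
          exact Set.mem_Ioi.2 (mul_pos (by positivity : (0 : ℝ) < 2 ^ k) ht)
      have hb := (((h₁lim.comp (hscale.comp
        (tendsto_comap (f := (Prod.snd : (Fin n → ℝ) × ℝ → ℝ))))).const_mul (a k)).mul_const
          C₂).mul_const C₃
      simp only [mul_zero, zero_mul] at hb
      exact squeeze_zero' (hl.mono fun p hp => hf0 p hp k) (hl.mono fun p hp => hf₁ p hp k) hb
  · have hl : ∀ᶠ p : (Fin n → ℝ) × ℝ in comap Prod.snd atTop, 0 < p.2 :=
      tendsto_comap.eventually (eventually_gt_atTop 0)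
    have h := hlim _ hl (fun k => ?_) hε
    · obtain ⟨M, h⟩ := eventually_atTop.1 (eventually_comap.1 h)
      exact ⟨max M 1, by positivity, fun c ℓ hℓ =>
        h ℓ ((le_max_left M 1).trans hℓ.le) (c, ℓ) rfl⟩
    · have hb := ((h₂lim.comp (tendsto_comap (f := (Prod.snd : (Fin n → ℝ) × ℝ → ℝ)))).mul_const
        C₃).const_mul (a k * C₁)
      simp only [mul_zero, zero_mul] at hb
      refine squeeze_zero' (hl.mono fun p hp => hf0 p hp k) (hl.mono fun p hp => ?_) hb
      exact (hf₂₃ p hp k).trans (mul_le_mul_of_nonneg_left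
        (mul_le_mul_of_nonneg_left (h₃ _ (harg hp _ k)) (h₂0 _ hp.le))
        (mul_nonneg (ha k) hC₁.le))
  · have hl : ∀ᶠ p : (Fin n → ℝ) × ℝ in comap (fun p => ‖p.1‖) atTop ⊓ 𝓟 {p | 0 < p.2},
        0 < p.2 := mem_inf_of_right (mem_principal_self _)
    have h := hlim _ hl (fun k => ?_) hε
    · rw [eventually_inf_principal, eventually_comap] at h
      obtain ⟨R, h⟩ := eventually_atTop.1 h
      exact ⟨max R 1, by positivity, fun c ℓ hℓ hc =>
        h ‖c‖ ((le_max_left R 1).trans hc.le) (c, ℓ) rfl hℓ⟩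
    · have hb : Tendsto (fun p : (Fin n → ℝ) × ℝ =>
          F₂ p.2 * F₃ (2 * |‖p.1‖ - p.2| / (1 + 2 ^ k * p.2)))
          (comap (fun p => ‖p.1‖) atTop ⊓ 𝓟 {p | 0 < p.2}) (𝓝 0) := by
        refine tendsto_order.2 ⟨fun b hb => hl.mono fun p hp => hb.trans_le
          (mul_nonneg (h₂0 _ hp.le) (h₃0 _ (harg hp _ k))), fun η hη => ?_⟩
        obtain ⟨R, hR⟩ := exists_mul_lt_of_decay (A := 2 ^ k) (by positivity) hC₂ hC₃
          h₂0 h₂ h₂lim h₃0 h₃ h₃lim hη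
        rw [eventually_inf_principal]
        filter_upwards [tendsto_comap.eventually (eventually_ge_atTop R)] with p hpR hp
        exact hR _ _ hp hpR
      have hb' := hb.const_mul (a k * C₁)
      rw [mul_zero] at hb'
      exact squeeze_zero' (hl.mono fun p hp => hf0 p hp k) (hl.mono fun p hp => hf₂₃ p hp k) hb'
end
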